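/- arXiv:2312.11438 — 2 statements merged into one kernel-verified Lean document; each statement's English description precedes it below -/
import Mathlib

section
/- If a sequence (ν_n) of Borel probability measures on ℝ^d satisfies sup_n (∫ |x|² dν_n + ∫ ν_n log ν_n) < +∞ (in particular each ν_n is absolutely continuous with respect to Lebesgue measure with density again denoted ν_n), then the densities {ν_n} are uniformly integrable and precompact in the weak topology of L¹(ℝ^d). -/
open Filter Set Topology MeasureTheory

noncomputable section

lemma key (a q L w W : ℝ) (ha : 0 ≤ a) (hL : 0 < L) (hw : 0 ≤ w) (hW : w ≤ W) :
    w * a ≤ Real.exp L * (w * Real.exp (-q)) + W / L * (q * a + a * Real.log a + Real.exp (-q)) := by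
  have hg := Real.exp_pos (-q)
  have hu : a ≤ q * a + a * Real.log a + Real.exp (-q) := by
    rcases ha.eq_or_lt with rfl | ha
    · simpa using hg.le
    have h1 := Real.one_sub_inv_le_log_of_pos (x := a / Real.exp (-q)) (by positivity)
    rw [Real.log_div ha.ne' hg.ne', Real.log_exp] at h1
    have := mul_le_mul_of_nonneg_left h1 ha.le
    have e : a * (1 - (a / Real.exp (-q))⁻¹) = a - Real.exp (-q) := by field_simp
    linarith
  by_cases h : a ≤ Real.exp L * Real.exp (-q)
  · have : 0 ≤ W / L * (q * a + a * Real.log a + Real.exp (-q)) :=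
      mul_nonneg (div_nonneg (hw.trans hW) hL.le) (ha.trans hu)
    nlinarith
  · push Not at h
    have ha' : 0 < a := lt_trans (by positivity) h
    rw [← Real.exp_add, ← Real.lt_log_iff_exp_lt ha'] at h
    have h2 : L * a ≤ q * a + a * Real.log a + Real.exp (-q) := by nlinarith
    have h3 : w * a ≤ W / L * (L * a) := by
      rw [← mul_assoc, div_mul_cancel₀ _ hL.ne']; gcongr
    have h4 : W / L * (L * a) ≤ W / L * (q * a + a * Real.log a + Real.exp (-q)) :=
      mul_le_mul_of_nonneg_left h2 (div_nonneg (hw.trans hW) hL.le)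
    have : 0 ≤ Real.exp L * (w * Real.exp (-q)) := by positivity
    linarith
lemma integral_wd {α} [MeasurableSpace α] {μ : Measure α} {g : α → ℝ} (hg : Measurable g) (h0 : ∀ x, 0 ≤ g x) (w : α → ℝ) :
    ∫ x, w x ∂(μ.withDensity fun x => ENNReal.ofReal (g x)) = ∫ x, w x * g x ∂μ := by
  rw [integral_withDensity_eq_integral_toReal_smul (by fun_prop) (by simp)]
  simp [h0, mul_comm]

lemma integrable_gauss (d : ℕ) :
    Integrable (fun x : EuclideanSpace ℝ (Fin d) => Real.exp (-‖x‖^2)) := by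
  have h := (GaussianFourier.integrable_cexp_neg_mul_sq_norm_add (b := 1) (by simp) 0
    (0 : EuclideanSpace ℝ (Fin d))).norm
  simpa [Complex.norm_exp, ← Complex.ofReal_pow] using h

lemma integrable_of_bdd {α : Type*} [MeasurableSpace α] (μ : Measure α) [IsFiniteMeasure μ]
    {w : α → ℝ} (hw : Measurable w) {W : ℝ} (h : ∀ x, |w x| ≤ W) : Integrable w μ :=
  Integrable.of_bound hw.aestronglyMeasurable W (Eventually.of_forall h)

/-- Uniform integrability against `μ`, function form. -/
def UIf {E ι : Type*} [MeasurableSpace E] (μ : Measure E) (ν : ι → ProbabilityMeasure E) : Prop :=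
  ∀ ε > 0, ∀ W > 0, ∃ δ > 0, ∀ n, ∀ w : E → ℝ, Measurable w → (∀ x, 0 ≤ w x) → (∀ x, w x ≤ W) →
    ∫ x, w x ∂μ ≤ δ → ∫ x, w x ∂(ν n : Measure E) ≤ ε

lemma UIf.sets {E ι : Type*} [MeasurableSpace E] {μ : Measure E} [IsFiniteMeasure μ]
    {ν : ι → ProbabilityMeasure E}
    (H : UIf μ ν) {ε : ℝ} (hε : 0 < ε) : ∃ δ : ℝ, 0 < δ ∧ ∀ n s, MeasurableSet s →
      μ s ≤ ENNReal.ofReal δ → (ν n : Measure E) s ≤ ENNReal.ofReal ε := by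
  obtain ⟨δ, hδ, h⟩ := H ε hε 1 one_pos
  refine ⟨δ, hδ, fun n s hs hμ => ?_⟩
  have := h n (s.indicator 1) (measurable_one.indicator hs)
    (fun x => indicator_nonneg (by simp) x)
    (fun x => by by_cases hx : x ∈ s <;> simp [hx])
    (by rw [integral_indicator_one hs]; exact ENNReal.toReal_le_of_le_ofReal hδ.le hμ)
  rw [integral_indicator_one hs] at this
  exact (ENNReal.le_ofReal_iff_toReal_le (measure_ne_top _ _) hε.le).2 this

lemma dunford {E : Type*} [MetricSpace E] [CompleteSpace E] [SecondCountableTopology E]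
    [MeasurableSpace E] [BorelSpace E] (μ : Measure E) [IsFiniteMeasure μ]
    (ν : ℕ → ProbabilityMeasure E) (H : UIf μ ν) :
    ∃ t : ℕ → ℕ, StrictMono t ∧ ∃ ρ : ProbabilityMeasure E, (ρ : Measure E) ≪ μ ∧
      ∀ ψ : E → ℝ, Measurable ψ → (∃ M : ℝ, ∀ x, |ψ x| ≤ M) →
        Tendsto (fun k => ∫ x, ψ x ∂(ν (t k) : Measure E)) atTop (𝓝 (∫ x, ψ x ∂(ρ : Measure E))) := by
  have tight : IsTightMeasureSet {x : Measure E | ∃ m ∈ range ν, (m : Measure E) = x} := by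
    rw [isTightMeasureSet_iff_exists_isCompact_measure_compl_le]
    intro ε hε
    by_cases htop : ε = ⊤
    · exact ⟨∅, isCompact_empty, by simp [htop]⟩
    obtain ⟨δ, hδ, h⟩ := H.sets (ENNReal.toReal_pos hε.ne' htop)
    obtain ⟨K, hK, hKμ⟩ := (isTightMeasureSet_iff_exists_isCompact_measure_compl_le.1
      (isTightMeasureSet_singleton (μ := μ))) (ENNReal.ofReal δ) (by simpa using hδ)
    refine ⟨K, hK, ?_⟩
    rintro _ ⟨_, ⟨n, rfl⟩, rfl⟩
    have := h n Kᶜ hK.measurableSet.compl (hKμ μ rfl)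
    rwa [ENNReal.ofReal_toReal htop] at this
  obtain ⟨ρ, -, t, ht, hlim⟩ := (isCompact_closure_of_isTightMeasureSet tight).tendsto_subseq
    (x := ν) (fun n => subset_closure (mem_range_self n))
  refine ⟨t, ht, ρ, ?_, ?_⟩
  · intro A hA
    refine le_antisymm (ENNReal.le_of_forall_pos_le_add fun ε hε _ => ?_) bot_le
    obtain ⟨δ, hδ, h⟩ := H.sets (ε := ε) (by exact_mod_cast hε)
    obtain ⟨U, hAU, hU, hUδ⟩ := A.exists_isOpen_lt_of_lt (μ := μ) (ENNReal.ofReal δ)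
      (by rw [hA]; simpa using hδ)
    calc (ρ : Measure E) A ≤ (ρ : Measure E) U := measure_mono hAU
      _ ≤ atTop.liminf fun i => ((ν ∘ t) i : Measure E) U :=
        ProbabilityMeasure.le_liminf_measure_open_of_tendsto hlim hU
      _ ≤ atTop.liminf fun i : ℕ => (ε : ENNReal) := by
        refine liminf_le_liminf (Eventually.of_forall fun i => ?_)
        have := h (t i) U hU.measurableSet hUδ.le
        simpa using this
      _ = 0 + ε := by simp
  · rintro ψ hψ ⟨M₀, hM₀⟩
    obtain ⟨M, hM, hMpos⟩ : ∃ M : ℝ, (∀ x, |ψ x| ≤ M) ∧ 0 < M :=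
      ⟨max M₀ 1, fun x => (hM₀ x).trans (le_max_left _ _), by positivity⟩
    rw [Metric.tendsto_atTop]
    intro ε hε
    obtain ⟨δ, hδ, h⟩ := H (ε / 4) (by positivity) (2 * M) (by positivity)
    have hψi := integrable_of_bdd (μ + (ρ : Measure E)) hψ hM
    obtain ⟨φ₀, hφ₀, hφ₀i⟩ := hψi.exists_boundedContinuous_integral_sub_le
      (ε := min δ (ε / 4)) (by positivity)
    have hφc : Continuous fun x => max (-M) (min M (φ₀ x)) := by fun_prop
    have hφb : ∀ x, |max (-M) (min M (φ₀ x))| ≤ M := fun x => by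
      rw [abs_le]; exact ⟨le_max_left _ _, max_le (by linarith) (min_le_left _ _)⟩
    let φ : BoundedContinuousFunction E ℝ :=
      BoundedContinuousFunction.ofNormedAddCommGroup _ hφc M hφb
    have hφM : ∀ x, |φ x| ≤ M := hφb
    have hφm : Measurable φ := hφc.measurable
    set w : E → ℝ := fun x => |ψ x - φ x| with hw
    have hwm : Measurable w := by fun_prop
    have hw0 : ∀ x, 0 ≤ w x := fun x => abs_nonneg _
    have hwM : ∀ x, w x ≤ 2 * M := fun x => by
      have := abs_sub (ψ x) (φ x)
      linarith [hM x, hφM x]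
    have hwi : ∀ (m : Measure E) [IsFiniteMeasure m], Integrable w m := fun m _ =>
      integrable_of_bdd m hwm (W := 2 * M) fun x => by rw [abs_of_nonneg (hw0 x)]; exact hwM x
    have hle : ∫ x, w x ∂(μ + (ρ : Measure E)) ≤ min δ (ε / 4) := by
      refine le_trans (integral_mono (hwi _) (hψi.sub hφ₀i).norm fun x => ?_) hφ₀
      show |ψ x - max (-M) (min M (φ₀ x))| ≤ |ψ x - φ₀ x|
      have hx := abs_le.1 (hM x)
      have e : ψ x = max (-M) (min M (ψ x)) := by
        rw [min_eq_right hx.2, max_eq_right hx.1]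
      conv_lhs => rw [e]
      calc _ ≤ |min M (ψ x) - min M (φ₀ x)| := by
            simpa using abs_max_sub_max_le_max (-M) (min M (ψ x)) (-M) (min M (φ₀ x))
        _ ≤ _ := by simpa using abs_min_sub_min_le_max M (ψ x) M (φ₀ x)
    rw [integral_add_measure (hwi _) (hwi _)] at hle
    have n1 : 0 ≤ ∫ x, w x ∂μ := integral_nonneg hw0
    have n2 : 0 ≤ ∫ x, w x ∂(ρ : Measure E) := integral_nonneg hw0
    have l1 := hle.trans (min_le_left _ _)
    have l2 := hle.trans (min_le_right _ _)
    have diff : ∀ m : ProbabilityMeasure E, |∫ x, ψ x ∂(m : Measure E) - ∫ x, φ x ∂(m : Measure E)|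
        ≤ ∫ x, w x ∂(m : Measure E) := fun m => by
      rw [← integral_sub (integrable_of_bdd _ hψ hM) (integrable_of_bdd _ hφm hφM)]
      exact abs_integral_le_integral_abs
    have hconv := (ProbabilityMeasure.tendsto_iff_forall_integral_tendsto.1 hlim) φ
    obtain ⟨N, hN⟩ := Metric.tendsto_atTop.1 hconv (ε / 4) (by positivity)
    refine ⟨N, fun k hk => ?_⟩
    have a1 := hN k hk
    have a2 := (diff (ν (t k))).trans (h (t k) w hwm hw0 hwM (by linarith))
    have a3 := diff ρ
    simp only [Function.comp_apply] at a1
    rw [Real.dist_eq] at a1 ⊢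
    rw [abs_lt] at a1 ⊢
    rw [abs_le] at a2 a3
    constructor <;> linarith [a1.1, a1.2, a2.1, a2.2, a3.1, a3.2]

/-- If a sequence of probability densities `f n` on `ℝ^d` has uniformly bounded
second moments and entropies, then the densities are uniformly integrable and
the sequence is precompact in the weak topology of `L¹(ℝ^d)` (every subsequence
has a further subsequence converging weakly in `L¹`). -/
theorem statement15 (d : ℕ) (hd : 0 < d)
    (f : ℕ → EuclideanSpace ℝ (Fin d) → ℝ)
    (hmeas : ∀ n, Measurable (f n))
    (hnonneg : ∀ n x, 0 ≤ f n x)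
    (hint : ∀ n, Integrable (f n))
    (hprob : ∀ n, ∫ x, f n x = 1)
    (hm2int : ∀ n, Integrable fun x : EuclideanSpace ℝ (Fin d) => ‖x‖ ^ 2 * f n x)
    (hentint : ∀ n, Integrable fun x : EuclideanSpace ℝ (Fin d) =>
      f n x * Real.log (f n x))
    (hbound : ∃ B : ℝ, ∀ n,
      (∫ x, ‖x‖ ^ 2 * f n x) + ∫ x, f n x * Real.log (f n x) ≤ B) :
    UnifIntegrable f 1 volume ∧
      ∀ s : ℕ → ℕ, StrictMono s →
        ∃ t : ℕ → ℕ, StrictMono t ∧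
          ∃ g : EuclideanSpace ℝ (Fin d) → ℝ, Integrable g ∧
            ∀ ψ : EuclideanSpace ℝ (Fin d) → ℝ, Measurable ψ →
              (∃ M : ℝ, ∀ x, |ψ x| ≤ M) →
              Tendsto (fun k => ∫ x, ψ x * f (s (t k)) x) atTop
                (𝓝 (∫ x, ψ x * g x)) := by
  classical
  obtain ⟨B, hB⟩ := hbound
  have hgi := integrable_gauss d
  have hgm : Measurable (fun x : EuclideanSpace ℝ (Fin d) => Real.exp (-‖x‖^2)) := by fun_prop
  have hg0 : ∀ x : EuclideanSpace ℝ (Fin d), 0 ≤ Real.exp (-‖x‖^2) := fun x => (Real.exp_pos _).le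
  set μ : Measure (EuclideanSpace ℝ (Fin d)) :=
    volume.withDensity (fun x => ENNReal.ofReal (Real.exp (-‖x‖^2))) with hμ
  have hμfin : IsFiniteMeasure μ := isFiniteMeasure_withDensity_ofReal hgi.2
  have hμvol : μ ≤ volume := by
    calc μ ≤ volume.withDensity 1 := withDensity_mono (Eventually.of_forall fun x => by
          simp)
      _ = volume := withDensity_one
  have hνp : ∀ n, IsProbabilityMeasure (volume.withDensity (fun x => ENNReal.ofReal (f n x))) :=
    fun n => ⟨by
      rw [withDensity_apply _ MeasurableSet.univ, setLIntegral_univ,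
        ← ofReal_integral_eq_lintegral_ofReal (hint n) (Eventually.of_forall (hnonneg n)), hprob n]
      simp⟩
  let ν : ℕ → ProbabilityMeasure (EuclideanSpace ℝ (Fin d)) := fun n => ⟨_, hνp n⟩
  have hνint : ∀ n (w : EuclideanSpace ℝ (Fin d) → ℝ),
      ∫ x, w x ∂(ν n : Measure (EuclideanSpace ℝ (Fin d))) = ∫ x, w x * f n x :=
    fun n w => integral_wd (hmeas n) (hnonneg n) w
  have hμint : ∀ (w : EuclideanSpace ℝ (Fin d) → ℝ),
      ∫ x, w x ∂μ = ∫ x, w x * Real.exp (-‖x‖^2) :=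
    fun w => integral_wd hgm hg0 w
  have H : UIf μ ν := by
    intro ε hε W hW
    set C : ℝ := max B 0 + ∫ x : EuclideanSpace ℝ (Fin d), Real.exp (-‖x‖^2) with hC
    have hC0 : 0 ≤ C := add_nonneg (le_max_right _ _) (integral_nonneg hg0)
    set L : ℝ := 2 * W * C / ε + 1 with hL
    have hLpos : 0 < L := by positivity
    refine ⟨ε / 2 * Real.exp (-L), by positivity, fun n w hwm hw0 hwW hwδ => ?_⟩
    rw [hμint] at hwδ
    rw [hνint]
    have hwa : ∀ x, ‖w x‖ ≤ W := fun x => by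
      rw [Real.norm_eq_abs, abs_of_nonneg (hw0 x)]; exact hwW x
    have i1 : Integrable fun x => w x * f n x :=
      (hint n).bdd_mul hwm.aestronglyMeasurable (Eventually.of_forall hwa)
    have i2 : Integrable fun x => w x * Real.exp (-‖x‖^2) :=
      hgi.bdd_mul hwm.aestronglyMeasurable (Eventually.of_forall hwa)
    have i3 : Integrable fun x => ‖x‖^2 * f n x + f n x * Real.log (f n x) :=
      (hm2int n).add (hentint n)
    have i4 : Integrable fun x => ‖x‖^2 * f n x + f n x * Real.log (f n x) + Real.exp (-‖x‖^2) :=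
      i3.add hgi
    have step : ∫ x, w x * f n x ≤ ∫ x, (Real.exp L * (w x * Real.exp (-‖x‖^2)) +
        W / L * (‖x‖^2 * f n x + f n x * Real.log (f n x) + Real.exp (-‖x‖^2))) :=
      integral_mono i1 ((i2.const_mul _).add (i4.const_mul _))
        fun x => key (f n x) (‖x‖^2) L (w x) W (hnonneg n x) hLpos (hw0 x) (hwW x)
    rw [integral_add (i2.const_mul _) (i4.const_mul _), integral_const_mul, integral_const_mul,
      integral_add i3 hgi, integral_add (hm2int n) (hentint n)] at step
    have s1 : Real.exp L * ∫ x, w x * Real.exp (-‖x‖^2) ≤ ε / 2 := by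
      calc _ ≤ Real.exp L * (ε / 2 * Real.exp (-L)) := by gcongr
        _ = ε / 2 := by rw [Real.exp_neg]; field_simp
    have s2 : W / L * ((∫ x, ‖x‖^2 * f n x) + (∫ x, f n x * Real.log (f n x)) +
        ∫ x : EuclideanSpace ℝ (Fin d), Real.exp (-‖x‖^2)) ≤ W / L * C := by
      have := (hB n).trans (le_max_left B 0)
      gcongr
      linarith
    have s3 : W / L * C ≤ ε / 2 := by
      rw [div_mul_eq_mul_div, div_le_iff₀ hLpos, hL]
      have : ε / 2 * (2 * W * C / ε + 1) = W * C + ε / 2 := by field_simp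
      linarith
    linarith
  constructor
  · intro ε hε
    obtain ⟨δ, hδ, h⟩ := H.sets hε
    refine ⟨δ, hδ, fun n s hs hsδ => ?_⟩
    have := h n s hs ((hμvol s).trans hsδ)
    rw [eLpNorm_one_eq_lintegral_enorm]
    refine le_trans (le_of_eq ?_) this
    show _ = volume.withDensity (fun x => ENNReal.ofReal (f n x)) s
    rw [withDensity_apply _ hs, ← lintegral_indicator hs]
    refine lintegral_congr fun x => ?_
    by_cases hx : x ∈ s
    · simp [hx, Real.enorm_of_nonneg (hnonneg n x)]
    · simp [hx]
  · intro s hs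
    have H' : UIf μ (fun k => ν (s k)) := by
      intro ε hε W hW
      obtain ⟨δ, hδ, h⟩ := H ε hε W hW
      exact ⟨δ, hδ, fun n => h (s n)⟩
    obtain ⟨t, ht, ρ, hρ, hlim⟩ := dunford μ _ H'
    have hρ' : (ρ : Measure (EuclideanSpace ℝ (Fin d))) ≪ volume :=
      hρ.trans (withDensity_absolutelyContinuous _ _)
    refine ⟨t, ht, fun x => ((ρ : Measure (EuclideanSpace ℝ (Fin d))).rnDeriv volume x).toReal,
      Measure.integrable_toReal_rnDeriv, fun ψ hψ hb => ?_⟩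
    have := hlim ψ hψ hb
    simp only [hνint] at this
    rw [← integral_toReal_rnDeriv_mul hρ'] at this
    simpa only [mul_comm] using this
end
end

section
/- Let ν be a nonnegative Borel measure on [0,∞) × ℝ^d and E a ν-measurable set with ν(E) < ∞. Let g, g_n : ℝ → ℝ ∪ {+∞} be proper, convex, lower semicontinuous functions such that g_n epi-converges to g, int(dom(g)) ≠ ∅ and int(dom(g*)) ≠ ∅. If φ_n ∈ L¹(ν) converges weakly in L¹(ν) to φ ∈ L¹(ν), then liminf_{n→∞} ∫_E g_n(φ_n) dν ≥ ∫_E g(φ) dν. -/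
open Filter Set Topology MeasureTheory

noncomputable section
open scoped Classical ENNReal

/-- Convexity for extended-real-valued functions on `ℝ`. -/
def EConvex (f : ℝ → EReal) : Prop :=
  ∀ x y t : ℝ, 0 ≤ t → t ≤ 1 →
    f (t * x + (1 - t) * y) ≤ (t : EReal) * f x + ((1 - t : ℝ) : EReal) * f y

/-- An extended-real-valued function is proper if it is not identically `+∞`
and never takes the value `−∞`. -/
def EProper (f : ℝ → EReal) : Prop := (∃ a, f a ≠ ⊤) ∧ ∀ a, f a ≠ ⊥

/-- Legendre–Fenchel (convex) conjugate: `g*(b) = sup_a (a·b − g(a))`. -/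
def econj (f : ℝ → EReal) (b : ℝ) : EReal := ⨆ a : ℝ, ((a * b : ℝ) : EReal) - f a

/-- Epi-convergence of a sequence of extended-real-valued functions on `ℝ`. -/
def EpiConverges (gn : ℕ → ℝ → EReal) (g : ℝ → EReal) : Prop :=
  ∀ x : ℝ,
    (∀ xs : ℕ → ℝ, Tendsto xs atTop (𝓝 x) →
        g x ≤ liminf (fun n => gn n (xs n)) atTop) ∧
    ∃ xs : ℕ → ℝ, Tendsto xs atTop (𝓝 x) ∧
        limsup (fun n => gn n (xs n)) atTop ≤ g x

/-- The nonnegative part of an extended real, as an extended nonnegative real. -/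
def epos (x : EReal) : ℝ≥0∞ := if x = ⊤ then ⊤ else ENNReal.ofReal x.toReal

/-- The (possibly infinite) integral of an extended-real-valued function over a
set, defined as the difference of the integrals of its positive and negative
parts. -/
def eint {X : Type*} [MeasurableSpace X] (ν : Measure X) (E : Set X)
    (F : X → EReal) : EReal :=
  ((∫⁻ x in E, epos (max (F x) 0) ∂ν : ℝ≥0∞) : EReal) -
    ((∫⁻ x in E, epos (max (-F x) 0) ∂ν : ℝ≥0∞) : EReal)

/-- Convexity with real upper bounds. -/
lemma EConvex.bound {f : ℝ → EReal} (hf : EConvex f) {x y t p q : ℝ} (h0 : 0 ≤ t) (h1 : t ≤ 1)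
    (hx : f x ≤ (p : EReal)) (hy : f y ≤ (q : EReal)) :
    f (t * x + (1 - t) * y) ≤ ((t * p + (1 - t) * q : ℝ) : EReal) := by
  refine (hf x y t h0 h1).trans ?_
  push_cast
  have h0' : (0 : EReal) ≤ (t : EReal) := by exact_mod_cast h0
  have h1' : (0 : EReal) ≤ ((1 - t : ℝ) : EReal) := by
    have : 0 ≤ 1 - t := by linarith
    exact_mod_cast this
  have := add_le_add (mul_le_mul_of_nonneg_left hx h0') (mul_le_mul_of_nonneg_left hy h1')
  simpa using this

/-- Affine minorant. -/
def AffMin (f : ℝ → EReal) (b c : ℝ) : Prop := ∀ x, ((b * x - c : ℝ) : EReal) ≤ f x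

lemma econj_ne_top_iff {g : ℝ → EReal} (hg : EProper g) (b : ℝ) :
    econj g b ≠ ⊤ ↔ ∃ c, AffMin g b c := by
  obtain ⟨⟨a, ha⟩, hbot⟩ := hg
  constructor
  · intro h
    have hle : ∀ x, ((x * b : ℝ) : EReal) - g x ≤ econj g b := fun x =>
      le_iSup (fun a : ℝ => ((a * b : ℝ) : EReal) - g a) x
    have hb : econj g b ≠ ⊥ := by
      intro hb
      have := hle a
      rw [hb, le_bot_iff] at this
      lift g a to ℝ using ⟨ha, hbot a⟩ with r
      exact EReal.coe_ne_bot (a * b - r) (by exact_mod_cast this)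
    refine ⟨(econj g b).toReal, fun x => ?_⟩
    have hx := hle x
    lift econj g b to ℝ using ⟨h, hb⟩ with c
    by_cases hgx : g x = ⊤
    · simp [hgx]
    have := hbot x
    lift g x to ℝ using ⟨hgx, this⟩ with r
    rw [EReal.toReal_coe]
    have h2 : x * b - r ≤ c := by exact_mod_cast hx
    have : b * x - c ≤ r := by linarith
    exact_mod_cast this
  · rintro ⟨c, hc⟩ h
    have : econj g b ≤ (c : EReal) := by
      refine iSup_le fun x => ?_
      have hx := hc x
      by_cases hgx : g x = ⊤
      · simp [hgx]
      have := hbot x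
      lift g x to ℝ using ⟨hgx, this⟩ with r
      have h2 : b * x - c ≤ r := by exact_mod_cast hx
      have : x * b - r ≤ c := by linarith
      exact_mod_cast this
    rw [h] at this
    simp at this

lemma convex_affDom (g : ℝ → EReal) : Convex ℝ {b | ∃ c, AffMin g b c} := by
  rintro b ⟨c, hc⟩ b' ⟨c', hc'⟩ s t hs ht hst
  refine ⟨s * c + t * c', fun x => ?_⟩
  have : s * (b * x - c) + t * (b' * x - c') ≤ max (b * x - c) (b' * x - c') := by
    have h1 := mul_le_mul_of_nonneg_left (le_max_left (b * x - c) (b' * x - c')) hs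
    have h2 := mul_le_mul_of_nonneg_left (le_max_right (b * x - c) (b' * x - c')) ht
    calc _ ≤ _ := add_le_add h1 h2
      _ = (s + t) * max (b * x - c) (b' * x - c') := by ring
      _ = _ := by rw [hst, one_mul]
  have h3 : (s • b + t • b') * x - (s * c + t * c') ≤ max (b * x - c) (b' * x - c') := by
    simp only [smul_eq_mul]; linarith
  refine (EReal.coe_le_coe_iff.2 h3).trans ?_
  rcases max_choice (b * x - c) (b' * x - c') with h | h <;> rw [h]
  exacts [hc x, hc' x]

/-- Local uniform lower bound from epi-convergence. -/
lemma epi_local {gn : ℕ → ℝ → EReal} {g : ℝ → EReal} (hepi : EpiConverges gn g)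
    {h : ℝ → ℝ} (hh : Continuous h) {x : ℝ} (hx : (h x : EReal) < g x) :
    ∀ᶠ p in (atTop : Filter ℕ) ×ˢ 𝓝 x, (h p.2 : EReal) < gn p.1 p.2 := by
  by_contra hcon
  rw [not_eventually] at hcon
  obtain ⟨ns, hns, hp⟩ := exists_seq_forall_of_frequently hcon
  have hn1 : Tendsto (fun k => (ns k).1) atTop atTop := tendsto_fst.comp hns
  have hn2 : Tendsto (fun k => (ns k).2) atTop (𝓝 x) := tendsto_snd.comp hns
  obtain ⟨σ, hσ, hmono⟩ := strictMono_subseq_of_tendsto_atTop hn1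
  set u : ℕ → ℕ := (fun k => (ns k).1) ∘ σ with hu
  set v : ℕ → ℝ := (fun k => (ns k).2) ∘ σ with hv
  have hvt : Tendsto v atTop (𝓝 x) := hn2.comp hσ.tendsto_atTop
  set xs : ℕ → ℝ := Function.extend u v (fun _ => x) with hxs
  have hxsu : ∀ k, xs (u k) = v k := fun k => hmono.injective.extend_apply _ _ k
  have hxt : Tendsto xs atTop (𝓝 x) := by
    intro U hU
    obtain ⟨K, hK⟩ := eventually_atTop.1 (hvt hU)
    rw [mem_map]
    refine mem_atTop_sets.2 ⟨u K, fun n hn => ?_⟩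
    by_cases hex : ∃ k, u k = n
    · obtain ⟨k, rfl⟩ := hex
      rw [mem_preimage, hxsu]
      exact hK k (hmono.le_iff_le.1 hn)
    · rw [mem_preimage, hxs, Function.extend_apply' _ _ _ hex]
      exact mem_of_mem_nhds hU
  have hlim := (hepi x).1 xs hxt
  obtain ⟨m, hm1, hm2⟩ := EReal.lt_iff_exists_real_btwn.1 hx
  have e1 := eventually_lt_of_lt_liminf (hm2.trans_le hlim)
  have e2 : ∀ᶠ n in atTop, h (xs n) < m :=
    ((hh.tendsto x).comp hxt).eventually (gt_mem_nhds (EReal.coe_lt_coe_iff.1 hm1))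
  obtain ⟨k, hk1, hk2⟩ := ((hmono.tendsto_atTop).eventually (e1.and e2)).exists
  have hk := hp (σ k)
  have hk1' : (m : EReal) < gn (u k) (v k) := by rw [← hxsu]; exact hk1
  have hk2' : h (v k) < m := by rw [← hxsu]; exact hk2
  exact hk ((EReal.coe_lt_coe_iff.2 hk2').trans hk1')

lemma epi_compact {gn : ℕ → ℝ → EReal} {g : ℝ → EReal} (hepi : EpiConverges gn g)
    {h : ℝ → ℝ} (hh : Continuous h) {K : Set ℝ} (hK : IsCompact K)
    (hx : ∀ x ∈ K, (h x : EReal) < g x) :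
    ∀ᶠ n in atTop, ∀ x ∈ K, (h x : EReal) < gn n x := by
  have := hK.mem_prod_nhdsSet_of_forall (l := (atTop : Filter ℕ))
    (s := {p | (h p.2 : EReal) < gn p.1 p.2}) (fun y hy => epi_local hepi hh (hx y hy))
  obtain ⟨A, hA, B, hB, hAB⟩ := mem_prod_iff.1 this
  filter_upwards [hA] with n hn x hxK
  exact hAB (mk_mem_prod hn (subset_of_mem_nhdsSet hB hxK))

/-- A three-point consequence of convexity. -/
lemma EConvex.far {f : ℝ → EReal} (hf : EConvex f) {b c K y x R t : ℝ} (hK : 0 ≤ K)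
    (h0 : 0 ≤ t) (h1 : t ≤ 1) (hR : R = t * x + (1 - t) * y)
    (hy : f y ≤ ((b * y - c + K : ℝ) : EReal))
    (hfR : ((b * R - c + K : ℝ) : EReal) < f R) : ((b * x - c : ℝ) : EReal) ≤ f x := by
  by_contra hcon
  push Not at hcon
  have := hf.bound h0 h1 hcon.le hy
  rw [← hR] at this
  have h2 := EReal.coe_lt_coe_iff.1 (hfR.trans_le this)
  subst hR
  nlinarith

/-- Strict minorants of `g` with interior slope are eventually minorants of `gₙ`. -/
lemma eventually_affMin {gn : ℕ → ℝ → EReal} {g : ℝ → EReal} (hepi : EpiConverges gn g)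
    (hg : EProper g) (hgn : ∀ n, EConvex (gn n)) {b c : ℝ}
    (hb : b ∈ interior {b | ∃ c, AffMin g b c})
    (hs : ∀ x, ((b * x - c : ℝ) : EReal) < g x) : ∀ᶠ n in atTop, AffMin (gn n) b c := by
  obtain ⟨ε, hε, hball⟩ := Metric.isOpen_iff.1 isOpen_interior b hb
  have hmem : ∀ s : ℝ, |s| < ε → ∃ c, AffMin g (b + s) c := fun s hs' =>
    interior_subset (s := {b | ∃ c, AffMin g b c}) (hball (by simpa [Real.dist_eq] using hs'))
  set δ := ε / 2 with hδ
  have hδ0 : 0 < δ := by positivity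
  obtain ⟨C1, hC1⟩ := hmem δ (by rw [abs_of_pos hδ0]; linarith)
  obtain ⟨C2, hC2⟩ := hmem (-δ) (by rw [abs_neg, abs_of_pos hδ0]; linarith)
  obtain ⟨y, hy⟩ := hg.1
  obtain ⟨γ, hγ⟩ : ∃ γ : ℝ, g y = γ := ⟨(g y).toReal, (EReal.coe_toReal hy (hg.2 y)).symm⟩
  obtain ⟨ys, hys, hlim⟩ := (hepi y).2
  rw [hγ] at hlim
  have e1 : ∀ᶠ n in atTop, gn n (ys n) < ((γ + 1 : ℝ) : EReal) :=
    eventually_lt_of_limsup_lt (hlim.trans_lt (EReal.coe_lt_coe_iff.2 (by linarith)))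
  have e2 : ∀ᶠ n in atTop, |ys n - y| < 1 := by
    simpa [Real.dist_eq] using (Metric.tendsto_nhds.1 hys 1 one_pos)
  set K : ℝ := |γ + 1 + c| + |b| * (|y| + 1) with hK
  have hK0 : 0 ≤ K := by positivity
  set R : ℝ := |y| + 2 + (K + |C1| + |C2| + |c| + 1) / δ with hR
  have hRδ : K + |C1| + |C2| + |c| + 1 ≤ δ * R := by
    have : δ * R = δ * (|y| + 2) + (K + |C1| + |C2| + |c| + 1) := by
      rw [hR]; field_simp
    rw [this]
    have : 0 ≤ δ * (|y| + 2) := by positivity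
    linarith
  have hRy : |y| + 2 ≤ R := by
    have : 0 ≤ (K + |C1| + |C2| + |c| + 1) / δ := by positivity
    linarith
  have hR1 : ((b * R - c + K : ℝ) : EReal) < g R := by
    refine lt_of_lt_of_le (EReal.coe_lt_coe_iff.2 ?_) (hC1 R)
    have := le_abs_self C1; have := abs_nonneg C2; have := neg_abs_le c
    nlinarith
  have hR2 : ((b * (-R) - c + K : ℝ) : EReal) < g (-R) := by
    refine lt_of_lt_of_le (EReal.coe_lt_coe_iff.2 ?_) (hC2 (-R))
    have := le_abs_self C2; have := abs_nonneg C1; have := neg_abs_le c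
    nlinarith
  have e3 := epi_compact hepi (h := fun x => b * x - c + K) (by fun_prop) (K := {R})
    isCompact_singleton (by simpa using hR1)
  have e4 := epi_compact hepi (h := fun x => b * x - c + K) (by fun_prop) (K := {-R})
    isCompact_singleton (by simpa using hR2)
  have e5 := epi_compact hepi (h := fun x => b * x - c) (by fun_prop) (K := Icc (-R) R)
    isCompact_Icc (fun x _ => hs x)
  filter_upwards [e1, e2, e3, e4, e5] with n h1 h2 h3 h4 h5 x
  have h3' := h3 R rfl
  have h4' := h4 (-R) rfl
  have hysb : |ys n| < |y| + 1 := by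
    have := abs_sub_abs_le_abs_sub (ys n) y
    linarith
  have hysR := abs_lt.1 (hysb.trans_le (by linarith : |y| + 1 ≤ R))
  have hyK : gn n (ys n) ≤ ((b * ys n - c + K : ℝ) : EReal) := by
    refine h1.le.trans (EReal.coe_le_coe_iff.2 ?_)
    have a1 := le_abs_self (γ + 1 + c)
    have a2 : |b * ys n| ≤ |b| * (|y| + 1) := by
      rw [abs_mul]; gcongr
    have a3 := neg_abs_le (b * ys n)
    linarith
  by_cases hx : x ∈ Icc (-R) R
  · exact (h5 x hx).le
  · rw [mem_Icc, not_and_or] at hx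
    rcases hx with hx | hx
    · push Not at hx
      have hd : 0 < ys n - x := by linarith [hysR.1]
      refine (hgn n).far hK0 (t := (ys n + R) / (ys n - x)) (R := -R)
        (div_nonneg (by linarith [hysR.1]) hd.le)
        ((div_le_one hd).2 (by linarith)) ?_ hyK h4'
      field_simp; ring
    · push Not at hx
      have hd : 0 < x - ys n := by linarith [hysR.2]
      refine (hgn n).far hK0 (t := (R - ys n) / (x - ys n)) (R := R)
        (div_nonneg (by linarith [hysR.2]) hd.le)
        ((div_le_one hd).2 (by linarith)) ?_ hyK h3'
      field_simp; ring

/-- Any value below `g x₀` is exceeded by some affine minorant (Hahn–Banach). -/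
lemma exists_affMin {g : ℝ → EReal} (hg : EProper g) (hconv : EConvex g)
    (hlsc : LowerSemicontinuous g) {b0 c0 : ℝ} (h0 : AffMin g b0 c0) {x0 r : ℝ}
    (hr : (r : EReal) < g x0) : ∃ b c, AffMin g b c ∧ r < b * x0 - c := by
  set T : Set (ℝ × ℝ) := {p | g p.1 ≤ ((p.2 : ℝ) : EReal)} with hT
  have hTc : IsClosed T := by
    have h1 := hlsc.isClosed_epigraph
    exact h1.preimage (f := fun p : ℝ × ℝ => (p.1, ((p.2 : ℝ) : EReal)))
      (continuous_fst.prodMk (continuous_coe_real_ereal.comp continuous_snd))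
  have hTconv : Convex ℝ T := by
    rintro ⟨x, p⟩ hx ⟨y, q⟩ hy s t hs ht hst
    have ht' : t = 1 - s := by linarith
    subst ht'
    exact hconv.bound hs (by linarith) hx hy
  have hnot : (x0, r) ∉ T := fun h => absurd hr (not_lt.2 h)
  obtain ⟨F, u, hu, hF⟩ := geometric_hahn_banach_point_closed hTconv hTc hnot
  set α := F (1, 0) with hα
  set β := F (0, 1) with hβ
  have hFe : ∀ x s : ℝ, F (x, s) = α * x + β * s := by
    intro x s
    have : ((x, s) : ℝ × ℝ) = x • ((1 : ℝ), (0 : ℝ)) + s • ((0 : ℝ), (1 : ℝ)) := by simp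
    rw [this, map_add, map_smul, map_smul]
    simp only [smul_eq_mul]; ring
  rw [hFe] at hu
  have hF' : ∀ x s : ℝ, g x ≤ (s : EReal) → u < α * x + β * s := fun x s h => by
    rw [← hFe]; exact hF (x, s) h
  obtain ⟨y, hy⟩ := hg.1
  obtain ⟨γ, hγ⟩ : ∃ γ : ℝ, g y = γ := ⟨(g y).toReal, (EReal.coe_toReal hy (hg.2 y)).symm⟩
  have hβ0 : 0 ≤ β := by
    by_contra hneg
    push Not at hneg
    have hs := hF' y (max γ ((u - α * y) / β)) (by
      rw [hγ]; exact EReal.coe_le_coe_iff.2 (le_max_left _ _))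
    have h2 := mul_le_mul_of_nonpos_left (le_max_right γ ((u - α * y) / β)) hneg.le
    have h3 : β * ((u - α * y) / β) = u - α * y := by
      field_simp [hneg.ne]
    linarith
  rcases hβ0.eq_or_lt with hβz | hβp
  · rw [← hβz] at hu hF'
    have hux : 0 < u - α * x0 := by linarith
    set lam : ℝ := (|r - (b0 * x0 - c0)| + 1) / (u - α * x0) with hlam
    have hlam0 : 0 ≤ lam := by positivity
    refine ⟨b0 - lam * α, c0 - lam * u, fun x => ?_, ?_⟩
    · by_cases hx : g x = ⊤
      · simp [hx]
      refine (EReal.coe_le_coe_iff.2 ?_).trans (h0 x)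
      have := hF' x (g x).toReal (EReal.coe_toReal hx (hg.2 x)).ge
      have h4 : lam * u ≤ lam * (α * x) := mul_le_mul_of_nonneg_left (by linarith) hlam0
      nlinarith
    · have h5 : lam * (u - α * x0) = |r - (b0 * x0 - c0)| + 1 := by
        rw [hlam, div_mul_cancel₀ _ hux.ne']
      have := le_abs_self (r - (b0 * x0 - c0))
      nlinarith
  · refine ⟨-α / β, -u / β, fun x => ?_, ?_⟩
    · by_cases hx : g x = ⊤
      · simp [hx]
      have h1 := hF' x (g x).toReal (EReal.coe_toReal hx (hg.2 x)).ge
      rw [← EReal.coe_toReal hx (hg.2 x)]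
      refine EReal.coe_le_coe_iff.2 ?_
      have : -α / β * x - -u / β = (u - α * x) / β := by ring
      rw [this, div_le_iff₀ hβp]
      linarith
    · have : -α / β * x0 - -u / β = (u - α * x0) / β := by ring
      rw [this, lt_div_iff₀ hβp]
      linarith

/-- The strict affine minorants of `g` whose slope is interior to the domain of `g*`. -/
def StrictMin (g : ℝ → EReal) : Set (ℝ × ℝ) :=
  {p | p.1 ∈ interior {b | ∃ c, AffMin g b c} ∧ ∀ x, ((p.1 * x - p.2 : ℝ) : EReal) < g x}

lemma exists_strictMin {g : ℝ → EReal} (hg : EProper g) (hconv : EConvex g)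
    (hlsc : LowerSemicontinuous g) (hne : (interior {b | ∃ c, AffMin g b c}).Nonempty) {x0 r : ℝ}
    (hr : (r : EReal) < g x0) : ∃ p ∈ StrictMin g, r < p.1 * x0 - p.2 := by
  obtain ⟨b0, hb0⟩ := hne
  obtain ⟨c0, h0⟩ := interior_subset hb0
  obtain ⟨b, c, hbc, hrb⟩ := exists_affMin hg hconv hlsc h0 hr
  set A := b * x0 - c - r with hA
  have hA0 : 0 < A := by linarith
  set B := |b * x0 - c - (b0 * x0 - c0)| with hB
  have hB0 : 0 ≤ B := abs_nonneg _
  set t := A / (2 * (A + B)) with ht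
  have ht0 : 0 < t := by positivity
  have ht1 : t ≤ 1 := by rw [ht, div_le_one (by positivity)]; linarith
  have htB : t * B ≤ A / 2 := by
    rw [ht, div_mul_eq_mul_div, div_le_iff₀ (by positivity)]; nlinarith
  refine ⟨(t * b0 + (1 - t) * b, t * c0 + (1 - t) * c + A / 4), ⟨?_, fun x => ?_⟩, ?_⟩
  · exact (convex_affDom g).combo_interior_self_mem_interior hb0 ⟨c, hbc⟩ ht0
      (by linarith) (by ring)
  · have h1 : (t * b0 + (1 - t) * b) * x - (t * c0 + (1 - t) * c + A / 4)
        < max (b0 * x - c0) (b * x - c) := by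
      have h1 := mul_le_mul_of_nonneg_left (le_max_left (b0 * x - c0) (b * x - c)) ht0.le
      have h2 := mul_le_mul_of_nonneg_left (le_max_right (b0 * x - c0) (b * x - c))
        (by linarith : 0 ≤ 1 - t)
      linarith
    refine (EReal.coe_lt_coe_iff.2 h1).trans_le ?_
    rcases max_choice (b0 * x - c0) (b * x - c) with h | h <;> rw [h]
    exacts [h0 x, hbc x]
  · have h3 : t * (b * x0 - c - (b0 * x0 - c0)) ≤ t * B :=
      mul_le_mul_of_nonneg_left (le_abs_self _) ht0.le
    simp only
    linarith

/-- A countable family of strict minorants whose supremum is `g`. -/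
lemma exists_seq_strictMin {g : ℝ → EReal} (hg : EProper g) (hconv : EConvex g)
    (hlsc : LowerSemicontinuous g) (hne : (interior {b | ∃ c, AffMin g b c}).Nonempty) :
    ∃ p : ℕ → ℝ × ℝ, (∀ i, p i ∈ StrictMin g) ∧
      ∀ x r : ℝ, (r : EReal) < g x → ∃ i, r < (p i).1 * x - (p i).2 := by
  have hg0 : ((g 0).toReal - 1 : ℝ) < g 0 := by
    by_cases h : g 0 = ⊤
    · rw [h]; exact EReal.coe_lt_top _
    · conv_rhs => rw [← EReal.coe_toReal h (hg.2 0)]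
      exact EReal.coe_lt_coe_iff.2 (by linarith)
  obtain ⟨p0, hp0, -⟩ := exists_strictMin hg hconv hlsc hne hg0
  have : Nonempty (StrictMin g) := ⟨⟨p0, hp0⟩⟩
  refine ⟨fun i => (TopologicalSpace.denseSeq (StrictMin g) i : ℝ × ℝ),
    fun i => (TopologicalSpace.denseSeq (StrictMin g) i).2, fun x r hr => ?_⟩
  obtain ⟨p, hp, hpr⟩ := exists_strictMin hg hconv hlsc hne hr
  have hopen : IsOpen {q : StrictMin g | r < (q : ℝ × ℝ).1 * x - (q : ℝ × ℝ).2} :=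
    isOpen_lt continuous_const (by fun_prop)
  obtain ⟨i, hi⟩ := (TopologicalSpace.denseRange_denseSeq (StrictMin g)).exists_mem_open hopen
    ⟨⟨p, hp⟩, hpr⟩
  exact ⟨i, hi⟩

/-- Index of a maximal affine function among the first `k + 1`. -/
def argIdx (L : ℕ → ℝ → ℝ) : ℕ → ℝ → ℕ
  | 0, _ => 0
  | k + 1, y => if L (argIdx L k y) y < L (k + 1) y then k + 1 else argIdx L k y

lemma argIdx_le (L : ℕ → ℝ → ℝ) (k : ℕ) (y : ℝ) : argIdx L k y ≤ k := by
  induction k with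
  | zero => simp [argIdx]
  | succ k ih => rw [argIdx]; split_ifs <;> omega

lemma argIdx_step (L : ℕ → ℝ → ℝ) (k : ℕ) (y : ℝ) :
    L (argIdx L k y) y ≤ L (argIdx L (k + 1) y) y ∧ L (k + 1) y ≤ L (argIdx L (k + 1) y) y := by
  rw [argIdx]
  split_ifs with h
  · exact ⟨h.le, le_rfl⟩
  · exact ⟨le_rfl, not_lt.1 h⟩

lemma argIdx_mono (L : ℕ → ℝ → ℝ) (y : ℝ) : Monotone fun k => L (argIdx L k y) y :=
  monotone_nat_of_le_succ fun k => (argIdx_step L k y).1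

lemma le_argIdx (L : ℕ → ℝ → ℝ) (k : ℕ) (y : ℝ) : L k y ≤ L (argIdx L k y) y := by
  cases k with
  | zero => simp [argIdx]
  | succ k => exact (argIdx_step L k y).2

lemma measurable_argIdx {b c : ℕ → ℝ} (k : ℕ) :
    Measurable (argIdx (fun i y => b i * y - c i) k) := by
  induction k with
  | zero => exact measurable_const
  | succ k ih =>
    have hb : Measurable fun y => b (argIdx (fun i y => b i * y - c i) k y) :=
      (measurable_from_nat (f := b)).comp ih
    have hc : Measurable fun y => c (argIdx (fun i y => b i * y - c i) k y) :=
      (measurable_from_nat (f := c)).comp ih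
    exact Measurable.ite (measurableSet_lt ((hb.mul measurable_id).sub hc)
      ((measurable_id.const_mul _).sub_const _)) measurable_const ih

lemma epos_max (x : EReal) : epos (max x 0) = x.toENNReal := by
  have : epos (max x 0) = (max x 0).toENNReal := rfl
  rw [this]
  rcases le_total x 0 with h | h
  · rw [max_eq_right h, EReal.toENNReal_of_nonpos h, EReal.toENNReal_zero]
  · rw [max_eq_left h]

lemma toENNReal_coe_real (x : ℝ) : (x : EReal).toENNReal = ENNReal.ofReal x := by
  rw [EReal.toENNReal_of_ne_top (EReal.coe_ne_top x), EReal.toReal_coe]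

section
variable {X : Type*} [MeasurableSpace X] {ν : Measure X} {E : Set X}

lemma eint_eq (F : X → EReal) : eint ν E F =
    ((∫⁻ x in E, (F x).toENNReal ∂ν : ℝ≥0∞) : EReal) -
    ((∫⁻ x in E, (-F x).toENNReal ∂ν : ℝ≥0∞) : EReal) := by
  simp only [eint, epos_max]

lemma coe_integral_eq {f : X → ℝ} (hf : IntegrableOn f E ν) :
    ((∫ x in E, f x ∂ν : ℝ) : EReal) =
    ((∫⁻ x in E, ENNReal.ofReal (f x) ∂ν : ℝ≥0∞) : EReal) -
    ((∫⁻ x in E, ENNReal.ofReal (-f x) ∂ν : ℝ≥0∞) : EReal) := by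
  rw [integral_eq_lintegral_pos_part_sub_lintegral_neg_part hf]
  have h1 : ∫⁻ x in E, ENNReal.ofReal (f x) ∂ν ≠ ⊤ := hf.lintegral_lt_top.ne
  have h2 : ∫⁻ x in E, ENNReal.ofReal (-f x) ∂ν ≠ ⊤ := hf.neg.lintegral_lt_top.ne
  rw [EReal.coe_sub, EReal.coe_ennreal_toReal h1, EReal.coe_ennreal_toReal h2]

lemma le_eint {f : X → ℝ} {F : X → EReal} (hf : IntegrableOn f E ν)
    (hle : ∀ x, (f x : EReal) ≤ F x) : ((∫ x in E, f x ∂ν : ℝ) : EReal) ≤ eint ν E F := by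
  rw [coe_integral_eq hf, eint_eq]
  refine EReal.sub_le_sub ?_ ?_
  · refine EReal.coe_ennreal_le_coe_ennreal_iff.2 (lintegral_mono fun x => ?_)
    rw [← toENNReal_coe_real]
    exact EReal.toENNReal_le_toENNReal (hle x)
  · refine EReal.coe_ennreal_le_coe_ennreal_iff.2 (lintegral_mono fun x => ?_)
    rw [← toENNReal_coe_real, EReal.coe_neg]
    exact EReal.toENNReal_le_toENNReal (EReal.neg_le_neg_iff.2 (hle x))

lemma tendsto_integral_eint {f : ℕ → X → ℝ} {F : X → EReal} (hf : ∀ k, IntegrableOn (f k) E ν)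
    (hmono : ∀ᵐ x ∂(ν.restrict E), Monotone fun k => f k x)
    (hlim : ∀ᵐ x ∂(ν.restrict E), Tendsto (fun k => (f k x : EReal)) atTop (𝓝 (F x))) :
    Tendsto (fun k => ((∫ x in E, f k x ∂ν : ℝ) : EReal)) atTop (𝓝 (eint ν E F)) := by
  have hP : Tendsto (fun k => ∫⁻ x in E, ENNReal.ofReal (f k x) ∂ν) atTop
      (𝓝 (∫⁻ x in E, (F x).toENNReal ∂ν)) := by
    refine lintegral_tendsto_of_tendsto_of_monotone
      (fun k => (hf k).1.aemeasurable.ennreal_ofReal) ?_ ?_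
    · filter_upwards [hmono] with x hx k l hkl
      exact ENNReal.ofReal_le_ofReal (hx hkl)
    · filter_upwards [hlim] with x hx
      simpa only [Function.comp_def, toENNReal_coe_real] using
        (EReal.continuous_toENNReal.tendsto _).comp hx
  have hN : Tendsto (fun k => ∫⁻ x in E, ENNReal.ofReal (-f k x) ∂ν) atTop
      (𝓝 (∫⁻ x in E, (-F x).toENNReal ∂ν)) := by
    refine tendsto_lintegral_of_dominated_convergence' (fun x => ENNReal.ofReal (-f 0 x))
      (fun k => (hf k).1.aemeasurable.neg.ennreal_ofReal) (fun k => ?_)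
      (hf 0).neg.lintegral_lt_top.ne ?_
    · filter_upwards [hmono] with x hx
      exact ENNReal.ofReal_le_ofReal (neg_le_neg (hx (Nat.zero_le k)))
    · filter_upwards [hlim] with x hx
      have := (EReal.continuous_toENNReal.tendsto _).comp ((continuous_neg.tendsto _).comp hx)
      simpa only [Function.comp_def, ← EReal.coe_neg, toENNReal_coe_real] using this
  have hNtop : ∫⁻ x in E, (-F x).toENNReal ∂ν ≠ ⊤ := by
    refine ne_top_of_le_ne_top (hf 0).neg.lintegral_lt_top.ne (le_of_tendsto' hN fun k => ?_)
    refine lintegral_mono_ae ?_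
    filter_upwards [hmono] with x hx
    exact ENNReal.ofReal_le_ofReal (neg_le_neg (hx (Nat.zero_le k)))
  rw [eint_eq]
  simp only [fun k => coe_integral_eq (hf k), sub_eq_add_neg]
  have hc := EReal.continuousAt_add (p := (((∫⁻ x in E, (F x).toENNReal ∂ν : ℝ≥0∞) : EReal),
    -((∫⁻ x in E, (-F x).toENNReal ∂ν : ℝ≥0∞) : EReal)))
    (Or.inr (by simpa using hNtop)) (Or.inl (EReal.coe_ennreal_ne_bot _))
  exact hc.tendsto.comp ((EReal.tendsto_coe_ennreal.2 hP).prodMk_nhds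
    ((continuous_neg.tendsto _).comp (EReal.tendsto_coe_ennreal.2 hN)))

lemma main_aux (hEmeas : MeasurableSet E) (hEfin : ν E < ⊤)
    (g : ℝ → EReal) (gn : ℕ → ℝ → EReal)
    (hg : EProper g ∧ EConvex g ∧ LowerSemicontinuous g)
    (hgn : ∀ n, EProper (gn n) ∧ EConvex (gn n) ∧ LowerSemicontinuous (gn n))
    (hepi : EpiConverges gn g)
    (hdomgstar : (interior {b : ℝ | econj g b ≠ ⊤}).Nonempty)
    (φ : X → ℝ) (φn : ℕ → X → ℝ)
    (hφ : Integrable φ ν) (hφn : ∀ n, Integrable (φn n) ν)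
    (hweak : ∀ ψ : X → ℝ, Measurable ψ →
      (∃ M : ℝ, ∀ x, |ψ x| ≤ M) →
      Tendsto (fun n => ∫ x, ψ x * φn n x ∂ν) atTop (𝓝 (∫ x, ψ x * φ x ∂ν))) :
    eint ν E (fun x => g (φ x)) ≤
      liminf (fun n => eint ν E (fun x => gn n (φn n x))) atTop := by
  have hset : {b : ℝ | econj g b ≠ ⊤} = {b | ∃ c, AffMin g b c} := by
    ext b; exact econj_ne_top_iff hg.1 b
  rw [hset] at hdomgstar
  obtain ⟨p, hp, hsup⟩ := exists_seq_strictMin hg.1 hg.2.1 hg.2.2 hdomgstar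
  set b : ℕ → ℝ := fun i => (p i).1 with hb
  set c : ℕ → ℝ := fun i => (p i).2 with hc
  set L : ℕ → ℝ → ℝ := fun i y => b i * y - c i with hL
  obtain ⟨φ', hφ'm, hφ'⟩ : ∃ φ' : X → ℝ, Measurable φ' ∧ φ =ᵐ[ν] φ' :=
    ⟨hφ.1.aemeasurable.mk φ, hφ.1.aemeasurable.measurable_mk, hφ.1.aemeasurable.ae_eq_mk⟩
  set J : ℕ → X → ℕ := fun k x => argIdx L k (φ' x) with hJ
  have hJm : ∀ k, Measurable (J k) := fun k => (measurable_argIdx k).comp hφ'm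
  have hbm : ∀ k, Measurable fun x => b (J k x) := fun k =>
    (measurable_from_nat (f := b)).comp (hJm k)
  have hcm : ∀ k, Measurable fun x => c (J k x) := fun k =>
    (measurable_from_nat (f := c)).comp (hJm k)
  have hbd : ∀ (a : ℕ → ℝ) k x, |a (J k x)| ≤ ∑ i ∈ Finset.range (k + 1), |a i| := by
    intro a k x
    refine Finset.single_le_sum (f := fun i => |a i|) (fun i _ => abs_nonneg _) ?_
    exact Finset.mem_range.2 (Nat.lt_succ_of_le (argIdx_le L k _))
  have : IsFiniteMeasure (ν.restrict E) := ⟨by simpa using hEfin⟩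
  have hcint : ∀ k, IntegrableOn (fun x => c (J k x)) E ν := fun k =>
    Integrable.of_bound (hcm k).aestronglyMeasurable _
      (ae_of_all _ fun x => by rw [Real.norm_eq_abs]; exact hbd c k x)
  have hbint : ∀ k (u : X → ℝ), Integrable u ν → IntegrableOn (fun x => b (J k x) * u x) E ν :=
    fun k u hu => hu.integrableOn.bdd_mul (hbm k).aestronglyMeasurable
      (ae_of_all _ fun x => by rw [Real.norm_eq_abs]; exact hbd b k x)
  have hint : ∀ k (u : X → ℝ), Integrable u ν →
      IntegrableOn (fun x => b (J k x) * u x - c (J k x)) E ν := fun k u hu =>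
    (hbint k u hu).sub (hcint k)
  have hφr : ∀ᵐ x ∂(ν.restrict E), φ x = φ' x := ae_restrict_of_ae hφ'
  have hT : Tendsto (fun k => ((∫ x in E, (b (J k x) * φ x - c (J k x)) ∂ν : ℝ) : EReal)) atTop
      (𝓝 (eint ν E (fun x => g (φ x)))) := by
    refine tendsto_integral_eint (fun k => hint k φ hφ) ?_ ?_
    · filter_upwards [hφr] with x hx
      simp only [hx]
      exact argIdx_mono L (φ' x)
    · filter_upwards [hφr] with x hx
      simp only [hx]
      refine tendsto_order.2 ⟨fun a ha => ?_, fun a ha => ?_⟩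
      · obtain ⟨r, hr1, hr2⟩ := EReal.lt_iff_exists_real_btwn.1 ha
        obtain ⟨i, hi⟩ := hsup _ _ hr2
        filter_upwards [eventually_ge_atTop i] with k hk
        refine hr1.trans (EReal.coe_lt_coe_iff.2 (hi.trans_le ?_))
        exact (le_argIdx L i (φ' x)).trans (argIdx_mono L (φ' x) hk)
      · exact Eventually.of_forall fun k => ((hp _).2 _).trans ha
  refine le_of_tendsto' hT fun k => ?_
  have hev : ∀ᶠ n in atTop, ∀ i ∈ Finset.range (k + 1), AffMin (gn n) (b i) (c i) :=
    (Finset.eventually_all _).2 fun i _ =>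
      eventually_affMin hepi hg.1 (fun n => (hgn n).2.1) (hp i).1 (hp i).2
  have hreal : Tendsto (fun n => ∫ x in E, (b (J k x) * φn n x - c (J k x)) ∂ν) atTop
      (𝓝 (∫ x in E, (b (J k x) * φ x - c (J k x)) ∂ν)) := by
    have hw := hweak (E.indicator fun x => b (J k x)) ((hbm k).indicator hEmeas)
      ⟨∑ i ∈ Finset.range (k + 1), |b i|, fun x => by
        by_cases hx : x ∈ E
        · rw [indicator_of_mem hx]; exact hbd b k x
        · rw [indicator_of_notMem hx, abs_zero]; positivity⟩
    have hconv : ∀ u : X → ℝ, ∫ x, E.indicator (fun x => b (J k x)) x * u x ∂ν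
        = ∫ x in E, b (J k x) * u x ∂ν := by
      intro u
      rw [← integral_indicator hEmeas]
      congr 1
      ext x
      by_cases hx : x ∈ E <;> simp [hx]
    simp only [hconv] at hw
    rw [integral_sub (hbint k φ hφ) (hcint k)]
    simp only [fun n => integral_sub (hbint k (φn n) (hφn n)) (hcint k)]
    exact hw.sub_const _
  rw [← (EReal.tendsto_coe.2 hreal).liminf_eq]
  refine liminf_le_liminf ?_
  filter_upwards [hev] with n hn
  refine le_eint (hint k _ (hφn n)) fun x => ?_
  exact hn _ (Finset.mem_range.2 (Nat.lt_succ_of_le (argIdx_le L k _))) _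

end

/-- Lower semicontinuity of integral functionals with varying convex integrands:
if `gₙ` epi-converges to `g` and `φₙ → φ` weakly in `L¹(ν)`, then
`liminf ∫_E gₙ(φₙ) dν ≥ ∫_E g(φ) dν`. -/
theorem statement16 (d : ℕ)
    (ν : Measure (ℝ × EuclideanSpace ℝ (Fin d)))
    (hsupp : ν {p : ℝ × EuclideanSpace ℝ (Fin d) | p.1 < 0} = 0)
    (E : Set (ℝ × EuclideanSpace ℝ (Fin d)))
    (hEmeas : MeasurableSet E) (hEfin : ν E < ⊤)
    (g : ℝ → EReal) (gn : ℕ → ℝ → EReal)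
    (hg : EProper g ∧ EConvex g ∧ LowerSemicontinuous g)
    (hgn : ∀ n, EProper (gn n) ∧ EConvex (gn n) ∧ LowerSemicontinuous (gn n))
    (hepi : EpiConverges gn g)
    (hdomg : (interior {a : ℝ | g a ≠ ⊤}).Nonempty)
    (hdomgstar : (interior {b : ℝ | econj g b ≠ ⊤}).Nonempty)
    (φ : ℝ × EuclideanSpace ℝ (Fin d) → ℝ)
    (φn : ℕ → ℝ × EuclideanSpace ℝ (Fin d) → ℝ)
    (hφ : Integrable φ ν) (hφn : ∀ n, Integrable (φn n) ν)
    (hweak : ∀ ψ : ℝ × EuclideanSpace ℝ (Fin d) → ℝ, Measurable ψ →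
      (∃ M : ℝ, ∀ x, |ψ x| ≤ M) →
      Tendsto (fun n => ∫ x, ψ x * φn n x ∂ν) atTop (𝓝 (∫ x, ψ x * φ x ∂ν))) :
    eint ν E (fun x => g (φ x)) ≤
      liminf (fun n => eint ν E (fun x => gn n (φn n x))) atTop := by
  exact main_aux hEmeas hEfin g gn hg hgn hepi hdomgstar φ φn hφ hφn hweak
end
end
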